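/- Let G be a countable group, μ a probability measure on G with H(μ) < ∞, and {μ_k}_{k≥1} probability measures on G with H(μ_k) < ∞, μ_k(g) → μ(g) for all g, and H(μ_k) → H(μ). Fix t₀ ≥ 1 and let W = (g_1,…,g_{t₀}) be a t₀-tuple of i.i.d. increments with law given by the product measure. Then for any ε > 0 there are δ > 0 and K ≥ 1 such that the following holds: for every subset E ⊆ G^{t₀} with μ^{t₀}(E) < δ, the random variable W̃ defined by W̃ = W if E occurs and W̃ = ⋆ otherwise satisfies H_{μ_k}(W̃) < ε for every k ≥ K. -/

import Mathlib

open Filter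

namespace RW


variable {G : Type*} [Group G]

/-- `μ` is a probability mass function on the countable group `G`. -/
def IsProb (μ : G → ℝ) : Prop := (∀ g, 0 ≤ μ g) ∧ HasSum μ 1

/-- Convolution of two measures: `(μ * ν)(g) = ∑_h μ(g h⁻¹) ν(h)`. -/
noncomputable def conv (μ ν : G → ℝ) : G → ℝ := fun g => ∑' h : G, μ (g * h⁻¹) * ν h

open Classical in
/-- `n`-fold convolution power of `μ`; `convPow μ 0` is the Dirac mass at the identity. -/
noncomputable def convPow (μ : G → ℝ) : ℕ → G → ℝ
  | 0 => fun g => if g = 1 then (1 : ℝ) else 0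
  | n + 1 => conv (convPow μ n) μ

/-- Shannon entropy `H(μ) = -∑_g μ(g) log μ(g)`. -/
noncomputable def entropy (μ : G → ℝ) : ℝ := ∑' g : G, Real.negMulLog (μ g)

/-- `H(μ) < ∞`. -/
def FiniteEntropy (μ : G → ℝ) : Prop := Summable fun g : G => Real.negMulLog (μ g)

/-- Asymptotic entropy `h(μ) = lim_n H(μ^{*n})/n` (the limit exists by subadditivity,
so it coincides with the `limsup`). -/
noncomputable def asympEntropy (μ : G → ℝ) : ℝ :=
  Filter.limsup (fun n : ℕ => entropy (convPow μ n) / (n : ℝ)) Filter.atTop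

/-- Position of the random walk at time `m`, given the sequence of increments `gs`
(0-indexed: the `i`-th increment is `g_{i+1} = gs i`), so `walk gs m = g_1 ⋯ g_m`. -/
def walk (gs : ℕ → G) (m : ℕ) : G := ((List.range m).map gs).prod

/-- Extend a finite tuple of increments to an infinite sequence, padding by `1`. -/
noncomputable def pad {n : ℕ} (gs : Fin n → G) : ℕ → G :=
  fun i => if h : i < n then gs ⟨i, h⟩ else 1

/-- Probability, for the random walk with step distribution `μ`, of an event `E` about the
increment sequence that only depends on the first `n` increments. -/
noncomputable def cylProb (μ : G → ℝ) (n : ℕ) (E : Set (ℕ → G)) : ℝ :=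
  ∑' gs : Fin n → G,
    Set.indicator {v : Fin n → G | pad v ∈ E} (fun v => ∏ i, μ (v i)) gs

/-- Escape probability `p_esc(μ) = P(w_m ≠ e for all m ≥ 1)`: the (decreasing) limit,
i.e. the infimum, of the probabilities of not returning to the identity up to time `n`. -/
noncomputable def escapeProb (μ : G → ℝ) : ℝ :=
  ⨅ n : ℕ, cylProb μ n {gs | ∀ m, 1 ≤ m → m ≤ n → walk gs m ≠ 1}

/-- The `μ`-random walk is transient. -/
def Transient (μ : G → ℝ) : Prop := 0 < escapeProb μ

/-- The subsemigroup generated by the support of `μ`, as a set. -/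
def suppSemigroup (μ : G → ℝ) : Set G :=
  (Subsemigroup.closure (Function.support μ) : Subsemigroup G)

/-- `μ` is non-degenerate: the semigroup generated by its support is all of `G`. -/
def NonDegenerate (μ : G → ℝ) : Prop := ∀ g : G, g ∈ suppSemigroup μ

/-- The semigroup generated by the support of `μ` is symmetric (closed under inversion). -/
def SymmetricSemigroup (μ : G → ℝ) : Prop := ∀ g ∈ suppSemigroup μ, g⁻¹ ∈ suppSemigroup μ

/-- Law of a random variable `X` of the increment sequence that only depends on the
first `n` increments. -/
noncomputable def law (μ : G → ℝ) (n : ℕ) {D : Type*} (X : (ℕ → G) → D) : D → ℝ :=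
  fun d => cylProb μ n {gs | X gs = d}

/-- Shannon entropy `H_μ(X)` of a random variable `X` of the increment sequence that only
depends on the first `n` increments. -/
noncomputable def entropyRV (μ : G → ℝ) (n : ℕ) {D : Type*} (X : (ℕ → G) → D) : ℝ :=
  ∑' d : D, Real.negMulLog (law μ n X d)

/-- Conditional entropy `H_μ(X | Y) = H_μ(X, Y) - H_μ(Y)`. -/
noncomputable def condEntropyRV (μ : G → ℝ) (n : ℕ) {D E : Type*}
    (X : (ℕ → G) → D) (Y : (ℕ → G) → E) : ℝ :=
  entropyRV μ n (fun gs => (X gs, Y gs)) - entropyRV μ n Y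

/-- Expectation `E_μ(X)` of a real random variable `X` of the increment sequence that only
depends on the first `n` increments. -/
noncomputable def expect (μ : G → ℝ) (n : ℕ) (X : (ℕ → G) → ℝ) : ℝ :=
  ∑' gs : Fin n → G, (∏ i, μ (gs i)) * X (pad gs)

/-- The `t₀`-coarse trajectory at instant `n`: `(w_{t₀}, w_{2t₀}, …, w_{⌊n/t₀⌋t₀})`. -/
def coarseTraj (t₀ n : ℕ) (gs : ℕ → G) : Fin (n / t₀) → G :=
  fun j => walk gs ((j.1 + 1) * t₀)

/-- The `n`-ball `(T ∪ {1})^n`: products of `n` elements of `T ∪ {1}`. -/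
def ballOf (T : Set G) (n : ℕ) : Set G :=
  {g | ∃ l : List G, l.length = n ∧ (∀ x ∈ l, x ∈ insert (1 : G) T) ∧ l.prod = g}

/-- The set `T` contains a finite symmetric set `S` generating a subgroup whose growth
function is at least `C n^d`. -/
def GrowthAtLeastWithin (T : Set G) (d : ℝ) : Prop :=
  ∃ S : Finset G, (S : Set G) ⊆ T ∧ (∀ s ∈ S, s⁻¹ ∈ S) ∧
    ∃ C : ℝ, 0 < C ∧ ∀ n : ℕ, 1 ≤ n →
      C * (n : ℝ) ^ d ≤ ((ballOf (S : Set G) n).ncard : ℝ)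

/-- `P_μ(∃ ℓ > n₀, w_ℓ ∈ F)`: the (increasing) limit, i.e. the supremum, over finite
horizons `m` of the probability of visiting `F` at some time in `(n₀, m]`. -/
noncomputable def returnProbAfter (μ : G → ℝ) (n₀ : ℕ) (F : Set G) : ℝ :=
  ⨆ m : ℕ, cylProb μ m {gs | ∃ ℓ, n₀ < ℓ ∧ ℓ ≤ m ∧ walk gs ℓ ∈ F}

/-- The set of `(n₀,t₀,F)`-unstable points at instant `n`. -/
def unstablePts (n₀ t₀ n : ℕ) (F : Set G) (gs : ℕ → G) : Set G :=
  {b | ∃ j, j ≤ n / t₀ - n₀ ∧ ∃ ℓ, ℓ ≤ n / t₀ ∧ j + n₀ < ℓ ∧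
    (∃ f ∈ F, walk gs (j * t₀) * f = b) ∧ (∃ f ∈ F, walk gs (ℓ * t₀) * f = b)}

/-- The set of visits to `(n₀,t₀,F)`-unstable points by time `n`. -/
def unstableVisits (n₀ t₀ n : ℕ) (F : Set G) (gs : ℕ → G) : Set ℕ :=
  {j | j ≤ n / t₀ - n₀ ∧ ∃ b ∈ unstablePts n₀ t₀ n F gs, ∃ f ∈ F, walk gs (j * t₀) * f = b}

/-- Product measure `μ^{t₀}` of a subset of `G^{t₀}`. -/
noncomputable def prodMeas (μ : G → ℝ) (t₀ : ℕ) (E : Set (Fin t₀ → G)) : ℝ :=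
  ∑' v : Fin t₀ → G, Set.indicator E (fun v => ∏ i, μ (v i)) v

open Classical in
/-- The random variable `W̃`: the tuple of the first `t₀` increments if the event `E`
occurs, and the extra symbol `⋆` (here `none`) otherwise. -/
noncomputable def obscure {t₀ : ℕ} (E : Set (Fin t₀ → G)) (gs : ℕ → G) :
    Option (Fin t₀ → G) :=
  if (fun i : Fin t₀ => gs i.1) ∈ E then some (fun i : Fin t₀ => gs i.1) else none

/-- A group `H` is ICC if it is non-trivial and every non-identity element has an
infinite conjugacy class. -/
def IsICC (H : Type*) [Group H] : Prop :=
  Nontrivial H ∧ ∀ h : H, h ≠ 1 → (Set.range fun g : H => g * h * g⁻¹).Infinite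

/-- A group is hyper-FC-central if it has no non-trivial ICC quotient. -/
def HyperFCCentral (G : Type*) [Group G] : Prop :=
  ∀ (N : Subgroup G) [N.Normal], ¬ IsICC (G ⧸ N)


open Topology in
/-- A Scheffé-type uniform absolute continuity principle: if nonnegative summable functions `fk k`
converge pointwise to `f`, with convergence of the total masses, and `f` vanishes wherever `p`
does, then `fk k` has small mass on every set of small `p`-mass, eventually in `k`. -/
lemma exists_pos_eventually_tsum_indicator_lt {ι κ : Type*} {l : Filter κ} {p f : ι → ℝ}
    {fk : κ → ι → ℝ} {S : ℝ} {Sk : κ → ℝ} (hp0 : ∀ v, 0 ≤ p v) (hp : Summable p)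
    (hf0 : ∀ k v, 0 ≤ fk k v) (hf : HasSum f S) (hfk : ∀ k, HasSum (fk k) (Sk k))
    (hpt : ∀ v, Tendsto (fun k => fk k v) l (𝓝 (f v))) (hlim : Tendsto Sk l (𝓝 S))
    (hpf : ∀ v, p v = 0 → f v = 0) {ε : ℝ} (hε : 0 < ε) :
    ∃ δ : ℝ, 0 < δ ∧ ∀ᶠ k in l, ∀ E : Set ι,
      ∑' v, E.indicator p v < δ → ∑' v, E.indicator (fk k) v < ε := by
  classical
  obtain ⟨F, hF⟩ : ∃ F : Finset ι, S - ε / 4 < ∑ v ∈ F, f v :=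
    (Tendsto.eventually_const_lt (by linarith) hf).exists
  let F₀ := F.filter fun v => p v = 0
  obtain ⟨δ, hδ, hδF⟩ : ∃ δ : ℝ, 0 < δ ∧ ∀ v ∈ F, p v ≠ 0 → δ ≤ p v := by
    have h : ∀ᶠ δ in 𝓝[>] (0 : ℝ), ∀ v ∈ F, p v ≠ 0 → δ ≤ p v := by
      rw [Filter.eventually_all_finset]
      intro v _
      by_cases hv : p v = 0
      · simp [hv]
      · filter_upwards [Ioc_mem_nhdsGT ((hp0 v).lt_of_ne' hv)] with δ hδ _ using hδ.2
    obtain ⟨δ, h, hδ⟩ := (h.and self_mem_nhdsWithin).exists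
    exact ⟨δ, hδ, h⟩
  have hFlim : Tendsto (fun k => ∑ v ∈ F, fk k v) l (𝓝 (∑ v ∈ F, f v)) :=
    tendsto_finsetSum _ fun v _ => hpt v
  have hF₀lim : Tendsto (fun k => ∑ v ∈ F₀, fk k v) l (𝓝 0) := by
    have h : ∑ v ∈ F₀, f v = 0 :=
      Finset.sum_eq_zero fun v hv => hpf v (Finset.mem_filter.1 hv).2
    exact h ▸ tendsto_finsetSum _ fun v _ => hpt v
  refine ⟨δ, hδ, ?_⟩
  filter_upwards [hlim.eventually_lt_const (show S < S + ε / 4 by linarith),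
    hFlim.eventually_const_lt hF,
    hF₀lim.eventually_lt_const (show 0 < ε / 4 by linarith)] with k hS hFk hF₀k E hE
  have hfin : ∀ A : Finset ι,
      HasSum (fun v => if v ∈ A then fk k v else 0) (∑ v ∈ A, fk k v) := by
    intro A
    have h : HasSum (fun v => if v ∈ A then fk k v else 0) _ :=
      hasSum_sum_of_ne_finset_zero (s := A) fun v hv => if_neg hv
    rwa [Finset.sum_congr rfl fun v hv => if_pos hv] at h
  have hEp : ∀ v ∈ F, v ∈ E → p v = 0 := by
    intro v hvF hvE
    by_contra hv
    have h := (hp.indicator E).le_tsum v fun w _ => Set.indicator_nonneg (fun w _ => hp0 w) w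
    rw [Set.indicator_of_mem hvE] at h
    linarith [hδF v hvF hv]
  have hle : ∀ v, E.indicator (fk k) v ≤
      fk k v - (if v ∈ F then fk k v else 0) + (if v ∈ F₀ then fk k v else 0) := by
    intro v
    have h0 := hf0 k v
    by_cases hvE : v ∈ E <;> by_cases hvF : v ∈ F
    · simp [hvE, hvF, F₀, hEp v hvF hvE]
    · simp [hvE, hvF, F₀]
    · by_cases hv : p v = 0 <;> simp [hvE, hvF, F₀, hv, h0]
    · simp [hvE, hvF, F₀, h0]
  have h := hasSum_le hle ((hfk k).summable.indicator E).hasSum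
    (((hfk k).sub (hfin F)).add (hfin F₀))
  linarith

/-- Marginalizing the first coordinate of a sum over tuples. -/
lemma hasSum_fin_succ {X : Type*} {n : ℕ} {f : (Fin (n + 1) → X) → ℝ} {a : ℝ}
    (h : HasSum (fun x : X × (Fin n → X) => f (Fin.cons x.1 x.2)) a) : HasSum f a :=
  (Fin.consEquiv fun _ : Fin (n + 1) => X).hasSum_iff.1 h

/-- The product of `n` copies of a probability mass function is a probability mass function. -/
lemma hasSum_prod_pi {X : Type*} {ν : X → ℝ} (h0 : ∀ x, 0 ≤ ν x) (h : HasSum ν 1) (n : ℕ) :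
    HasSum (fun v : Fin n → X => ∏ i, ν (v i)) 1 := by
  induction n with
  | zero => simp
  | succ n ih =>
    apply hasSum_fin_succ
    have hs := h.summable.mul_of_nonneg ih.summable h0
      fun v => Finset.prod_nonneg fun i _ => h0 (v i)
    simpa [Fin.prod_univ_succ] using h.mul ih hs

/-- The entropy of the product of `n` copies of `ν` is `n` times the entropy of `ν`. -/
lemma hasSum_negMulLog_prod_pi {X : Type*} {ν : X → ℝ} {H : ℝ} (h0 : ∀ x, 0 ≤ ν x)
    (h : HasSum ν 1) (hH : HasSum (fun x => Real.negMulLog (ν x)) H) (n : ℕ) :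
    HasSum (fun v : Fin n → X => Real.negMulLog (∏ i, ν (v i))) (n * H) := by
  have hlog : ∀ x, 0 ≤ Real.negMulLog (ν x) := fun x =>
    Real.negMulLog_nonneg (h0 x) (le_hasSum h x fun y _ => h0 y)
  induction n with
  | zero => simp
  | succ n ih =>
    apply hasSum_fin_succ
    have hn := hasSum_prod_pi h0 h n
    have hn0 : ∀ v : Fin n → X, 0 ≤ ∏ i, ν (v i) := fun v =>
      Finset.prod_nonneg fun i _ => h0 (v i)
    have hnlog : ∀ v : Fin n → X, 0 ≤ Real.negMulLog (∏ i, ν (v i)) := fun v =>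
      Real.negMulLog_nonneg (hn0 v) (le_hasSum hn v fun w _ => hn0 w)
    have hs₁ := hH.summable.mul_of_nonneg hn.summable hlog hn0
    have hs₂ := h.summable.mul_of_nonneg ih.summable h0 hnlog
    have h₁ := hH.mul hn hs₁
    have h₂ := h.mul ih hs₂
    have hval : ((n + 1 : ℕ) : ℝ) * H = H * 1 + 1 * (n * H) := by
      push_cast
      ring
    simpa only [hval, Fin.prod_univ_succ, Fin.cons_zero, Fin.cons_succ, Real.negMulLog_mul,
      mul_comm (Real.negMulLog (ν _))] using h₁.add h₂

/-- A sum over `Option X` splits off the term at `none`. -/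
lemma hasSum_option {X : Type*} {f : Option X → ℝ} {a : ℝ}
    (h : HasSum (fun x => f (some x)) a) : HasSum f (a + f none) := by
  refine (Equiv.optionEquivSumPUnit.{0} X).symm.hasSum_iff.1 (HasSum.sum ?_ ?_)
  · exact h
  · exact hasSum_unique _

lemma obscure_pad {n : ℕ} (E : Set (Fin n → G)) (v : Fin n → G) [Decidable (v ∈ E)] :
    obscure E (pad v) = if v ∈ E then some v else none := by
  have h : (fun i : Fin n => pad v i.1) = v := by
    ext i
    simp [pad]
  simp only [obscure, h]

lemma law_obscure_some (ν : G → ℝ) {n : ℕ} (E : Set (Fin n → G)) (v : Fin n → G) :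
    law ν n (obscure E) (some v) = E.indicator (fun v => ∏ i, ν (v i)) v := by
  classical
  rw [law, cylProb, tsum_eq_single v]
  · simp [Set.indicator_apply, obscure_pad]
  · intro w hw
    simp [obscure_pad, hw]

lemma law_obscure_none (ν : G → ℝ) {n : ℕ} (E : Set (Fin n → G)) :
    law ν n (obscure E) none = ∑' v, Eᶜ.indicator (fun v => ∏ i, ν (v i)) v := by
  classical
  rw [law, cylProb]
  refine tsum_congr fun v => ?_
  simp [Set.indicator_apply, obscure_pad]

/-- The entropy of the obscured variable is at most the mass plus the entropy carried by `E`. -/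
lemma entropyRV_obscure_le {ν : G → ℝ} (hν : IsProb ν) (hH : FiniteEntropy ν) {n : ℕ}
    (E : Set (Fin n → G)) :
    entropyRV ν n (obscure E) ≤ ∑' v, E.indicator
      (fun v => ∏ i, ν (v i) + Real.negMulLog (∏ i, ν (v i))) v := by
  have hP := hasSum_prod_pi hν.1 hν.2 n
  have hL := hasSum_negMulLog_prod_pi hν.1 hν.2 hH.hasSum n
  have hPE := hP.summable.indicator E
  have hPc := hP.summable.indicator Eᶜ
  have hLE := hL.summable.indicator E
  have hsome : ∀ v, Real.negMulLog (law ν n (obscure E) (some v)) =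
      E.indicator (fun v => Real.negMulLog (∏ i, ν (v i))) v := by
    intro v
    rw [law_obscure_some]
    by_cases hv : v ∈ E <;> simp [hv]
  have hsum := hasSum_option (f := fun d => Real.negMulLog (law ν n (obscure E) d))
    (by simpa only [hsome] using hLE.hasSum)
  have hnone0 : 0 ≤ law ν n (obscure E) none := by
    rw [law_obscure_none]
    exact tsum_nonneg fun v => Set.indicator_nonneg
      (fun v _ => Finset.prod_nonneg fun i _ => hν.1 (v i)) v
  have hmass : ∑' v, E.indicator (fun v => ∏ i, ν (v i)) v + law ν n (obscure E) none = 1 := by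
    rw [law_obscure_none, ← hPE.tsum_add hPc, ← hP.tsum_eq]
    exact tsum_congr fun v => congrFun (Set.indicator_self_add_compl E _) v
  have hnone := Real.negMulLog_le_one_sub_self hnone0
  simp only [Set.indicator_add]
  rw [entropyRV, hsum.tsum_eq, hPE.tsum_add hLE]
  linarith

theorem uniform_obscuring
    {G : Type*} [Group G] [Countable G]
    (μ : G → ℝ) (hμ : IsProb μ) (hH : FiniteEntropy μ)
    (μk : ℕ → G → ℝ) (hμk : ∀ k, IsProb (μk k)) (hHk : ∀ k, FiniteEntropy (μk k))
    (hpt : ∀ g : G, Tendsto (fun k => μk k g) atTop (nhds (μ g)))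
    (hent : Tendsto (fun k => entropy (μk k)) atTop (nhds (entropy μ)))
    (t₀ : ℕ) (ht₀ : 1 ≤ t₀) :
    ∀ ε : ℝ, 0 < ε → ∃ δ : ℝ, 0 < δ ∧ ∃ K : ℕ, 1 ≤ K ∧
      ∀ E : Set (Fin t₀ → G), prodMeas μ t₀ E < δ →
        ∀ k, K ≤ k → entropyRV (μk k) t₀ (obscure E) < ε := by
  intro ε hε
  have hP := hasSum_prod_pi hμ.1 hμ.2 t₀
  have hP0 : ∀ ν : G → ℝ, IsProb ν → ∀ v : Fin t₀ → G, 0 ≤ ∏ i, ν (v i) := fun ν hν v =>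
    Finset.prod_nonneg fun i _ => hν.1 (v i)
  have hpt' : ∀ v : Fin t₀ → G,
      Tendsto (fun k => ∏ i, μk k (v i)) atTop (nhds (∏ i, μ (v i))) := fun v =>
    tendsto_finsetProd _ fun i _ => hpt (v i)
  have hlog0 : ∀ k (v : Fin t₀ → G), 0 ≤ Real.negMulLog (∏ i, μk k (v i)) := fun k v =>
    Real.negMulLog_nonneg (hP0 _ (hμk k) v)
      (le_hasSum (hasSum_prod_pi (hμk k).1 (hμk k).2 t₀) v fun w _ => hP0 _ (hμk k) w)
  have hsum : ∀ ν : G → ℝ, IsProb ν → FiniteEntropy ν → HasSum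
      (fun v : Fin t₀ → G => ∏ i, ν (v i) + Real.negMulLog (∏ i, ν (v i)))
      (1 + t₀ * entropy ν) := fun ν hν hνH =>
    (hasSum_prod_pi hν.1 hν.2 t₀).add (hasSum_negMulLog_prod_pi hν.1 hν.2 hνH.hasSum t₀)
  have hlim : ∀ v : Fin t₀ → G, Tendsto
      (fun k => ∏ i, μk k (v i) + Real.negMulLog (∏ i, μk k (v i))) atTop
      (nhds (∏ i, μ (v i) + Real.negMulLog (∏ i, μ (v i)))) := fun v =>
    (hpt' v).add ((Real.continuous_negMulLog.tendsto _).comp (hpt' v))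
  have hmass : Tendsto (fun k => 1 + t₀ * entropy (μk k)) atTop (nhds (1 + t₀ * entropy μ)) :=
    tendsto_const_nhds.add (hent.const_mul _)
  have hzero : ∀ v : Fin t₀ → G, ∏ i, μ (v i) = 0 →
      ∏ i, μ (v i) + Real.negMulLog (∏ i, μ (v i)) = 0 := fun v hv => by simp [hv]
  obtain ⟨δ, hδ, h⟩ := exists_pos_eventually_tsum_indicator_lt
    (hP0 μ hμ) hP.summable (fun k v => add_nonneg (hP0 _ (hμk k) v) (hlog0 k v))
    (hsum μ hμ hH) (fun k => hsum _ (hμk k) (hHk k)) hlim hmass hzero hε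
  obtain ⟨K, hK⟩ := eventually_atTop.1 h
  exact ⟨δ, hδ, max K 1, le_max_right _ _, fun E hE k hk =>
    (entropyRV_obscure_le (hμk k) (hHk k) E).trans_lt (hK k (le_of_max_le_left hk) E hE)⟩

end RW
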